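/- arXiv:2011.00707 — 2 statements merged into one kernel-verified Lean document; each statement's English description precedes it below -/
import Mathlib

section
/- Let d, N be positive integers with d < N, let B be a d×N integer matrix with columns b_1, …, b_N, let γ₀ ∈ ℝ^N, μ ∈ ℝ^d, and let I ⊆ {1,…,N} have cardinality d, enumerated as i_1,…,i_d, with det(B_I) ≠ 0 where B_I is the d×d submatrix of columns indexed by I. Define γ^μ_j = γ₀_j + μ·b_j, x_j = e^{2πiγ₀_j}, ζ = (e^{2πiμ_1},…,e^{2πiμ_d}), and assume γ^μ_j ∈ ℤ for all j ∈ I. Let J_I(ζ) be the determinant of the d×d matrix whose (r,c) entry is x_{i_c}·(B_{r,i_c})·ζ^{b_{i_c}}. Then for every τ ∈ ℝ^d, sign(det B_I) · e^{2πi μ·τ} / ( J_I(ζ) · ∏_{j ∉ I} (x_j ζ^{b_j} − 1) ) = e^{2πi μ·τ} / ( |det B_I| · ∏_{j ∉ I} (e^{2πi γ^μ_j} − 1) ). In particular J_I(ζ) = det(B_I) and each factor satisfies x_j ζ^{b_j} − 1 = e^{2πi γ^μ_j} − 1. -/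
open Complex Finset

/-- Lemma 8.1 with the Grothendieck residue replaced by its explicit defining formula:
`sign(det B_I) ζ^τ / (J_I(ζ) ∏_{j∉I} f_j(ζ)) = e^{2πiμ·τ}/(Δ_I ∏_{j∉I}(e^{2πiγ^μ_j}−1))`,
and in particular `J_I(ζ) = det B_I` and `x_j ζ^{b_j} − 1 = e^{2πiγ^μ_j} − 1`. -/
theorem residue_evaluation (d N : ℕ) (hd : 0 < d) (hdN : d < N)
    (b : Fin N → Fin d → ℤ) (γ₀ : Fin N → ℝ) (μ : Fin d → ℝ)
    (I : Finset (Fin N)) (hIcard : I.card = d)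
    (i : Fin d → Fin N) (hi : Function.Injective i)
    (hiI : Finset.image i Finset.univ = I)
    (BI : Matrix (Fin d) (Fin d) ℤ) (hBI : BI = Matrix.of fun r c => b (i c) r)
    (hdet : BI.det ≠ 0)
    (γμ : Fin N → ℝ) (hγμ : ∀ j, γμ j = γ₀ j + ∑ r, μ r * (b j r : ℝ))
    (hint : ∀ j ∈ I, ∃ n : ℤ, γμ j = (n : ℝ))
    (x : Fin N → ℂ) (hx : ∀ j, x j = Complex.exp (2 * Real.pi * Complex.I * (γ₀ j : ℂ)))
    (ζ : Fin d → ℂ) (hζ : ∀ r, ζ r = Complex.exp (2 * Real.pi * Complex.I * (μ r : ℂ)))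
    (JI : ℂ)
    (hJI : JI = Matrix.det (Matrix.of fun r c : Fin d =>
      x (i c) * (b (i c) r : ℂ) * ∏ s, ζ s ^ (b (i c) s))) :
    (∀ τ : Fin d → ℝ,
      (BI.det.sign : ℂ) *
          Complex.exp (2 * Real.pi * Complex.I * ((∑ s, μ s * τ s : ℝ) : ℂ)) /
          (JI * ∏ j ∈ Iᶜ, (x j * ∏ r, ζ r ^ (b j r) - 1)) =
        Complex.exp (2 * Real.pi * Complex.I * ((∑ s, μ s * τ s : ℝ) : ℂ)) /
          ((BI.det.natAbs : ℂ) *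
            ∏ j ∈ Iᶜ, (Complex.exp (2 * Real.pi * Complex.I * (γμ j : ℂ)) - 1))) ∧
    JI = (BI.det : ℂ) ∧
    ∀ j ∉ I, x j * ∏ r, ζ r ^ (b j r) - 1 =
      Complex.exp (2 * Real.pi * Complex.I * (γμ j : ℂ)) - 1 := by
  have key : ∀ j, x j * ∏ r, ζ r ^ (b j r) =
      Complex.exp (2 * Real.pi * Complex.I * (γμ j : ℂ)) := by
    intro j
    have h1 : ∀ r, ζ r ^ (b j r) =
        Complex.exp ((b j r : ℂ) * (2 * Real.pi * Complex.I * (μ r : ℂ))) := by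
      intro r
      rw [hζ, Complex.exp_int_mul]
    rw [Finset.prod_congr rfl (fun r _ => h1 r), ← Complex.exp_sum, hx, ← Complex.exp_add, hγμ]
    congr 1
    push_cast
    rw [mul_add, Finset.mul_sum]
    congr 1
    refine Finset.sum_congr rfl fun r _ => ?_
    ring
  have hJ : JI = (BI.det : ℂ) := by
    have h2 : (BI.det : ℂ) = (BI.map (Int.castRingHom ℂ)).det := by
      have := RingHom.map_det (Int.castRingHom ℂ) BI
      simpa using this
    rw [h2, hJI]
    congr 1
    ext r c
    have hc : i c ∈ I := by
      rw [← hiI]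
      exact Finset.mem_image_of_mem _ (Finset.mem_univ _)
    obtain ⟨n, hn⟩ := hint _ hc
    have h3 : x (i c) * ∏ s, ζ s ^ (b (i c) s) = 1 := by
      rw [key, hn, Complex.exp_eq_one_iff]
      exact ⟨n, by push_cast; ring⟩
    simp only [Matrix.of_apply, Matrix.map_apply, hBI]
    rw [mul_right_comm, h3]
    simp
  refine ⟨fun τ => ?_, hJ, fun j _ => by rw [key]⟩
  rw [hJ, Finset.prod_congr rfl (fun j _ => by rw [key j])]
  have h4 : (BI.det : ℂ) = (BI.det.sign : ℂ) * (BI.det.natAbs : ℂ) := by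
    have := Int.sign_mul_natAbs BI.det
    have h6 := congrArg (Int.cast : ℤ → ℂ) this
    rw [Int.cast_mul, Int.cast_natCast] at h6
    exact h6.symm
  have h5 : (BI.det.sign : ℂ) ≠ 0 := by
    exact_mod_cast fun h => hdet (Int.sign_eq_zero_iff_zero.mp h)
  rw [h4, mul_assoc (BI.det.sign : ℂ), mul_div_mul_left _ _ h5]
end

section
/- Let m ≥ 1, let β_1,…,β_m ∈ ℤ, let c_1,…,c_m ∈ ℂ* with c_j ≠ 1 whenever β_j = 0, and let a ∈ ℤ. For each j with β_j ≠ 0 let R_j = {w ∈ ℂ : c_j w^{β_j} = 1} (a finite set of nonzero complex numbers with |β_j| elements). Assume the sets R_j (over j with β_j ≠ 0) are pairwise disjoint, and assume ∑_{j : β_j < 0} β_j < a < ∑_{j : β_j > 0} β_j. Then ∑_{j : β_j ≠ 0} ∑_{w₀ ∈ R_j} w₀^a / ( β_j · ∏_{k ≠ j} (c_k w₀^{β_k} − 1) ) = 0. -/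
open Finset

open Polynomial in
/-- Sum of residues of `Q / P` for `P` with simple roots and `deg Q + 1 < deg P`. -/
lemma sum_eval_div_derivative (P Q : ℂ[X]) (S : Finset ℂ)
    (hS : ∀ w, w ∈ S ↔ P.eval w = 0) (hd : ∀ w ∈ S, P.derivative.eval w ≠ 0)
    (hdeg : Q.natDegree + 1 < P.natDegree) :
    ∑ w ∈ S, Q.eval w / P.derivative.eval w = 0 := by
  classical
  have hP : P ≠ 0 := by
    rintro rfl
    simp at hdeg
  have hnd : P.roots.Nodup := by
    rw [Multiset.nodup_iff_count_le_one]
    intro w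
    rw [count_roots]
    by_contra h
    push Not at h
    rw [one_lt_rootMultiplicity_iff_isRoot hP] at h
    exact hd w ((hS w).2 h.1) h.2
  have hval : P.roots = S.val := by
    refine Multiset.Nodup.ext hnd S.nodup |>.2 fun w => ?_
    rw [mem_roots hP, Finset.mem_val, hS]
    rfl
  have hsp : P.Splits := IsAlgClosed.splits P
  have hcard : S.card = P.natDegree := by
    rw [hsp.natDegree_eq_card_roots, hval]
    rfl
  have hPn : P = C P.leadingCoeff * Lagrange.nodal S id := by
    conv_lhs => rw [hsp.eq_prod_roots, hval]
    rfl
  have hQ : Q.degree < (S.card : ℕ) := by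
    refine lt_of_le_of_lt degree_le_natDegree ?_
    rw [hcard]
    exact_mod_cast (by omega)
  have h0 := Lagrange.coeff_eq_sum (s := S) (v := (id : ℂ → ℂ)) Function.injective_id.injOn hQ
  rw [coeff_eq_zero_of_natDegree_lt (by omega)] at h0
  have : ∀ w ∈ S, Q.eval w / P.derivative.eval w
      = P.leadingCoeff⁻¹ * (Q.eval (id w) / ∏ j ∈ S.erase w, (id w - id j)) := by
    intro w hw
    have h1 := Lagrange.eval_nodal_derivative_eval_node_eq (v := (id : ℂ → ℂ)) hw
    rw [Lagrange.eval_nodal] at h1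
    conv_lhs => rw [hPn]
    rw [derivative_C_mul, eval_C_mul, ← h1]
    simp only [id]
    rw [div_mul_eq_div_div, div_div, div_eq_mul_inv, mul_inv]
    ring
  rw [Finset.sum_congr rfl this, ← Finset.mul_sum, ← h0, mul_zero]

open Polynomial in
/-- The polynomial obtained from `c w^b - 1` by clearing the denominator. -/
noncomputable def facPoly (c : ℂ) (b : ℤ) : ℂ[X] := C c * X ^ b.toNat - X ^ (-b).toNat

lemma facPoly_eval (c : ℂ) (b : ℤ) (w : ℂ) (hw : w ≠ 0) :
    (facPoly c b).eval w = (c * w ^ b - 1) * w ^ (-b).toNat := by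
  have h : w ^ b * w ^ (-b).toNat = w ^ b.toNat := by
    rw [← zpow_natCast, ← zpow_natCast, ← zpow_add₀ hw]
    congr 1
    omega
  simp only [facPoly, Polynomial.eval_sub, Polynomial.eval_mul, Polynomial.eval_C,
    Polynomial.eval_pow, Polynomial.eval_X]
  rw [sub_mul, mul_assoc, h, one_mul]

lemma facPoly_eval_zero (c : ℂ) (b : ℤ) (hc : c ≠ 0) (hc1 : b = 0 → c ≠ 1) :
    (facPoly c b).eval 0 ≠ 0 := by
  simp only [facPoly, Polynomial.eval_sub, Polynomial.eval_mul, Polynomial.eval_C,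
    Polynomial.eval_pow, Polynomial.eval_X]
  rcases lt_trichotomy b 0 with h | h | h
  · have h1 : b.toNat = 0 := by omega
    have h2 : (-b).toNat ≠ 0 := by omega
    simp [h1, h2, hc]
  · subst h
    simpa [sub_eq_zero] using hc1 rfl
  · have h1 : b.toNat ≠ 0 := by omega
    have h2 : (-b).toNat = 0 := by omega
    simp [h1, h2]

lemma facPoly_ne_zero (c : ℂ) (b : ℤ) (hc : c ≠ 0) (hc1 : b = 0 → c ≠ 1) :
    facPoly c b ≠ 0 := by
  intro h
  apply facPoly_eval_zero c b hc hc1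
  simp [h]

open Polynomial in
lemma facPoly_natDegree (c : ℂ) (b : ℤ) (hc : c ≠ 0) :
    (facPoly c b).natDegree = b.toNat + (-b).toNat := by
  unfold facPoly
  rcases lt_trichotomy b 0 with h | h | h
  · have h1 : b.toNat = 0 := by omega
    have h2 : 0 < (-b).toNat := by omega
    rw [h1, natDegree_sub_eq_right_of_natDegree_lt]
    · simp
    · simpa using h2
  · subst h
    simp only [Int.toNat_zero, neg_zero, pow_zero, mul_one, add_zero]
    rw [← C_1, ← C_sub, natDegree_C]
  · have h1 : 0 < b.toNat := by omega
    have h2 : (-b).toNat = 0 := by omega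
    rw [h2, natDegree_sub_eq_left_of_natDegree_lt]
    · simp [natDegree_C_mul_X_pow _ _ hc]
    · simpa [natDegree_C_mul_X_pow _ _ hc] using h1

open Polynomial in
lemma facPoly_derivative (c : ℂ) (b : ℤ) (w : ℂ) (hw : w ≠ 0) (h : c * w ^ b = 1) :
    (facPoly c b).derivative.eval w * w = b * w ^ (-b).toNat := by
  have h0 : c * w ^ b.toNat = w ^ (-b).toNat := by
    have := facPoly_eval c b w hw
    rw [h, sub_self, zero_mul] at this
    simpa [facPoly, sub_eq_zero] using this
  have hp : ∀ n : ℕ, (n : ℂ) * w ^ (n - 1) * w = n * w ^ n := by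
    intro n
    cases n with
    | zero => simp
    | succ n => simp [pow_succ]; ring
  have hb : (b : ℂ) = (b.toNat : ℂ) - ((-b).toNat : ℂ) := by
    have : b = (b.toNat : ℤ) - ((-b).toNat : ℤ) := by omega
    exact_mod_cast congrArg (Int.cast : ℤ → ℂ) this
  have : (facPoly c b).derivative.eval w * w
      = c * ((b.toNat : ℂ) * w ^ (b.toNat - 1) * w)
        - ((-b).toNat : ℂ) * w ^ ((-b).toNat - 1) * w := by
    simp [facPoly, derivative_X_pow]
    ring
  rw [this, hp, hp, hb]
  linear_combination (b.toNat : ℂ) * h0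

/-- Analytic core of Proposition 8.4: the residues of the rational one-form
`w^a / ∏_k (c_k w^{β_k} − 1) · dw/w` at the pole sets `R_j = {w : c_j w^{β_j} = 1}`
sum to zero, given the zonotope inequality `∑_{β_j<0} β_j < a < ∑_{β_j>0} β_j`. -/
theorem sum_residues_eq_zero (m : ℕ) (hm : 1 ≤ m)
    (β : Fin m → ℤ) (c : Fin m → ℂ) (hc0 : ∀ j, c j ≠ 0)
    (hc1 : ∀ j, β j = 0 → c j ≠ 1)
    (a : ℤ)
    (R : Fin m → Finset ℂ)
    (hR : ∀ j, β j ≠ 0 → (R j : Set ℂ) = {w : ℂ | c j * w ^ (β j) = 1})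
    (hdisj : ∀ j j', β j ≠ 0 → β j' ≠ 0 → j ≠ j' → Disjoint (R j) (R j'))
    (ha₁ : (∑ j ∈ Finset.univ.filter fun j => β j < 0, β j) < a)
    (ha₂ : a < ∑ j ∈ Finset.univ.filter fun j => 0 < β j, β j) :
    ∑ j ∈ Finset.univ.filter fun j => β j ≠ 0,
      ∑ w₀ ∈ R j, w₀ ^ a / ((β j : ℂ) * ∏ k ∈ Finset.univ.erase j, (c k * w₀ ^ (β k) - 1))
      = 0 := by
  classical
  have hmem : ∀ j, β j ≠ 0 → ∀ w, w ∈ R j ↔ c j * w ^ (β j) = 1 := by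
    intro j hj w
    have := congrArg (fun s : Set ℂ => w ∈ s) (hR j hj)
    simpa using this
  have hne : ∀ j, β j ≠ 0 → ∀ w ∈ R j, w ≠ 0 := by
    rintro j hj w hw rfl
    rw [hmem j hj, zero_zpow _ hj] at hw
    simp at hw
  set J : Finset (Fin m) := Finset.univ.filter fun j => β j ≠ 0 with hJ
  have hJm : ∀ j, j ∈ J ↔ β j ≠ 0 := by simp [hJ]
  set P : Polynomial ℂ := ∏ k, facPoly (c k) (β k) with hP
  set S : Finset ℂ := J.biUnion R with hSdef
  set q : ℕ := ∑ k, (-β k).toNat with hq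
  set p : ℕ := ∑ k, (β k).toNat with hp
  have hneg : (∑ j ∈ Finset.univ.filter fun j => β j < 0, β j) = -(q : ℤ) := by
    rw [hq, Finset.sum_filter, Nat.cast_sum, ← Finset.sum_neg_distrib]
    refine Finset.sum_congr rfl fun j _ => ?_
    split_ifs <;> omega
  have hpos : (∑ j ∈ Finset.univ.filter fun j => 0 < β j, β j) = (p : ℤ) := by
    rw [hp, Finset.sum_filter, Nat.cast_sum]
    refine Finset.sum_congr rfl fun j _ => ?_
    split_ifs <;> omega
  rw [hneg] at ha₁
  rw [hpos] at ha₂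
  obtain ⟨e, he⟩ : ∃ e : ℕ, (e : ℤ) = a + q - 1 := ⟨(a + q - 1).toNat, by omega⟩
  have hdegP : P.natDegree = p + q := by
    rw [hP, Polynomial.natDegree_prod _ _ fun k _ => facPoly_ne_zero _ _ (hc0 k) (hc1 k),
      hp, hq, ← Finset.sum_add_distrib]
    exact Finset.sum_congr rfl fun k _ => facPoly_natDegree _ _ (hc0 k)
  have hfac : ∀ k w, (facPoly (c k) (β k)).eval w = 0 ↔ β k ≠ 0 ∧ w ∈ R k := by
    intro k w
    constructor
    · intro h
      have hw : w ≠ 0 := by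
        rintro rfl
        exact facPoly_eval_zero _ _ (hc0 k) (hc1 k) h
      rw [facPoly_eval _ _ _ hw] at h
      have h1 := (mul_eq_zero.1 h).resolve_right (pow_ne_zero _ hw)
      have hk : β k ≠ 0 := by
        intro hk
        rw [hk, zpow_zero, mul_one] at h1
        exact hc1 k hk (sub_eq_zero.1 h1)
      exact ⟨hk, (hmem k hk w).2 (sub_eq_zero.1 h1)⟩
    · rintro ⟨hk, hw⟩
      rw [facPoly_eval _ _ _ (hne k hk w hw), (hmem k hk w).1 hw, sub_self, zero_mul]
  have hS : ∀ w, w ∈ S ↔ P.eval w = 0 := by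
    intro w
    rw [hP, Polynomial.eval_prod, Finset.prod_eq_zero_iff]
    simp [hSdef, hfac, hJm]
  have hdP : ∀ j, β j ≠ 0 → ∀ w ∈ R j, P.derivative.eval w
      = (facPoly (c j) (β j)).derivative.eval w
        * ∏ k ∈ Finset.univ.erase j, (facPoly (c k) (β k)).eval w := by
    intro j hj w hw
    rw [hP, ← Finset.mul_prod_erase _ _ (Finset.mem_univ j), Polynomial.derivative_mul,
      Polynomial.eval_add, Polynomial.eval_mul, Polynomial.eval_mul, (hfac j w).2 ⟨hj, hw⟩,
      zero_mul, add_zero, Polynomial.eval_prod]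
  have hprod : ∀ j, β j ≠ 0 → ∀ w ∈ R j,
      ∏ k ∈ Finset.univ.erase j, (facPoly (c k) (β k)).eval w ≠ 0 := by
    intro j hj w hw
    rw [Finset.prod_ne_zero_iff]
    intro k hk h
    obtain ⟨hk1, hk2⟩ := (hfac k w).1 h
    exact Finset.disjoint_left.1 (hdisj j k hj hk1 (Finset.ne_of_mem_erase hk).symm) hw hk2
  have hdj : ∀ j, β j ≠ 0 → ∀ w ∈ R j, (facPoly (c j) (β j)).derivative.eval w ≠ 0 := by
    intro j hj w hw h
    have h1 := facPoly_derivative _ _ w (hne j hj w hw) ((hmem j hj w).1 hw)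
    rw [h, zero_mul] at h1
    exact mul_ne_zero (Int.cast_ne_zero.2 hj) (pow_ne_zero _ (hne j hj w hw)) h1.symm
  have key := sum_eval_div_derivative P (Polynomial.X ^ e) S hS (by
    intro w hw
    obtain ⟨j, hj, hwj⟩ := Finset.mem_biUnion.1 hw
    rw [hJm] at hj
    rw [hdP j hj w hwj]
    exact mul_ne_zero (hdj j hj w hwj) (hprod j hj w hwj)) (by
    rw [Polynomial.natDegree_X_pow, hdegP]
    omega)
  rw [hSdef, Finset.sum_biUnion (by
    intro j hj k hk hjk
    exact hdisj j k ((hJm j).1 hj) ((hJm k).1 hk) hjk)] at key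
  rw [← key]
  refine Finset.sum_congr rfl fun j hj => Finset.sum_congr rfl fun w hw => ?_
  rw [hJm] at hj
  have hw0 := hne j hj w hw
  have h1 := facPoly_derivative _ _ w hw0 ((hmem j hj w).1 hw)
  have h2 := hprod j hj w hw
  have h3 := hdj j hj w hw
  rw [hdP j hj w hw, Polynomial.eval_pow, Polynomial.eval_X]
  have h4 : ∏ k ∈ Finset.univ.erase j, (facPoly (c k) (β k)).eval w
      = (∏ k ∈ Finset.univ.erase j, (c k * w ^ (β k) - 1))
        * w ^ (∑ k ∈ Finset.univ.erase j, (-β k).toNat) := by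
    rw [← Finset.prod_pow_eq_pow_sum, ← Finset.prod_mul_distrib]
    exact Finset.prod_congr rfl fun k _ => facPoly_eval _ _ _ hw0
  have h5 : (-β j).toNat + ∑ k ∈ Finset.univ.erase j, (-β k).toNat = q :=
    Finset.add_sum_erase _ (fun k => (-β k).toNat) (Finset.mem_univ j)
  have h6 : w ^ a * w ^ q = w ^ e * w := by
    rw [← zpow_natCast, ← zpow_natCast, ← zpow_add₀ hw0, ← zpow_add_one₀ hw0]
    congr 1
    omega
  have h7 : (∏ k ∈ Finset.univ.erase j, (c k * w ^ (β k) - 1)) ≠ 0 := by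
    intro h
    rw [h4, h, zero_mul] at h2
    exact h2 rfl
  rw [div_eq_div_iff (mul_ne_zero (Int.cast_ne_zero.2 hj) h7) (mul_ne_zero h3 h2)]
  apply mul_right_cancel₀ hw0
  rw [h4]
  rw [← h5, pow_add] at h6
  linear_combination (w ^ a * (∏ k ∈ Finset.univ.erase j, (c k * w ^ (β k) - 1))
        * w ^ (∑ k ∈ Finset.univ.erase j, (-β k).toNat)) * h1
    + ((β j : ℂ) * (∏ k ∈ Finset.univ.erase j, (c k * w ^ (β k) - 1))) * h6
end
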